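/- arXiv:1806.11331 — 2 statements merged into one kernel-verified Lean document; each statement's English description precedes it below -/
import Mathlib

section
/- (First Generalized Jarník Lemma) Let (X, d) be a complete metric space and let A = ⋃_{n≥0} A_n be a diametrically strongly tree-like family of compact subsets of X with limit set A_∞. Suppose: (1) liminf_{n→∞} (log(1/d_n))/n > 0, where d_n = max{diam(A) : A ∈ A_n}; (2) there is a sequence (B_n)_{n≥1} in (0,1) with limsup_{n→∞} (log log(1/B_n))/(log n) < 1 such that for every n ≥ 1, every A ∈ A_n and all distinct Y, Z ∈ D(A), one has dist(Y, Z) ≥ B_n · diam(A); (3) for some s > 0 there exists c > 0 such that every finite subfamily X' ⊆ A with A_∞ ⊆ ⋃_{A ∈ X'} A satisfies Σ_{A ∈ X'} diam(A)^s > c. Then dim_H A_∞ ≥ s. -/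
open Filter Metric Set MeasureTheory
open scoped ENNReal NNReal

/-- Exponential decay of `d` beats the subexponential decay of `B`: at late stages the loss from
the separation constant `B n` is absorbed by lowering the exponent from `s` to `t`. -/
lemma eventually_rpow_le_rpow_of_growth {d B : ℕ → ℝ}
    (hgrow : 0 < liminf (fun n : ℕ => ((Real.log (1 / d n) / n : ℝ) : EReal)) atTop)
    (hB : ∀ n, 1 ≤ n → B n ∈ Ioo (0 : ℝ) 1)
    (hBlim : limsup
      (fun n : ℕ => ((Real.log (Real.log (1 / B n)) / Real.log n : ℝ) : EReal)) atTop < 1)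
    {s t : ℝ} (ht : 0 < t) (hts : t < s) :
    ∀ᶠ n in atTop, ∀ x r : ℝ, 0 < x → x ≤ d n → B n * x ≤ r → x ^ s ≤ r ^ t := by
  obtain ⟨κ, hκ0, hκ⟩ := EReal.lt_iff_exists_real_btwn.1 hgrow
  obtain ⟨e, he, he1⟩ := EReal.lt_iff_exists_real_btwn.1 hBlim
  have hκ0 : 0 < κ := by exact_mod_cast hκ0
  have he1 : e < 1 := by exact_mod_cast he1
  have hlim : Tendsto (fun n : ℕ => (n : ℝ) ^ (-(1 - e))) atTop (nhds 0) :=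
    (tendsto_rpow_neg_atTop (by linarith)).comp tendsto_natCast_atTop_atTop
  have hq : 0 < κ * (s - t) / t := div_pos (mul_pos hκ0 (by linarith)) ht
  filter_upwards [eventually_lt_of_lt_liminf hκ, eventually_lt_of_limsup_lt he,
    hlim.eventually_lt_const hq, eventually_ge_atTop 2] with n h1 h2 h3 hn x r hx hxd hxr
  have hn' : (2 : ℝ) ≤ n := by exact_mod_cast hn
  have hn0 : (0 : ℝ) < n := by linarith
  obtain ⟨hB0, hB1⟩ := hB n (by omega)
  have h1 : κ < Real.log (1 / d n) / n := by exact_mod_cast h1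
  have h2 : Real.log (Real.log (1 / B n)) / Real.log n < e := by exact_mod_cast h2
  rw [lt_div_iff₀ hn0, one_div, Real.log_inv] at h1
  have hlogB : 0 < Real.log (1 / B n) := Real.log_pos (by rw [lt_div_iff₀ hB0]; linarith)
  have h4 : Real.log (1 / B n) < (n : ℝ) ^ e := by
    rw [Real.lt_rpow_iff_log_lt hlogB hn0]
    rwa [div_lt_iff₀ (Real.log_pos (by linarith))] at h2
  rw [one_div, Real.log_inv] at h4
  have h5 : (n : ℝ) ^ e = (n : ℝ) ^ (-(1 - e)) * n := by
    nth_rewrite 3 [← Real.rpow_one (n : ℝ)]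
    rw [← Real.rpow_add hn0]
    congr 1
    ring
  have h6 : t * (n : ℝ) ^ e ≤ κ * (s - t) * n := by
    rw [lt_div_iff₀ ht] at h3
    rw [h5]
    nlinarith
  have hlogx : Real.log x ≤ Real.log (d n) := Real.log_le_log hx hxd
  have hr : 0 < r := (mul_pos hB0 hx).trans_le hxr
  have hlogr : Real.log (B n) + Real.log x ≤ Real.log r := by
    rw [← Real.log_mul hB0.ne' hx.ne']
    exact Real.log_le_log (mul_pos hB0 hx) hxr
  rw [← Real.log_le_log_iff (Real.rpow_pos_of_pos hx _) (Real.rpow_pos_of_pos hr _),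
    Real.log_rpow hx, Real.log_rpow hr]
  have h7 : t * (Real.log (B n) + Real.log x) ≤ t * Real.log r :=
    mul_le_mul_of_nonneg_left hlogr ht.le
  have h8 : t * -Real.log (B n) ≤ t * (n : ℝ) ^ e := mul_le_mul_of_nonneg_left h4.le ht.le
  have h9 : (s - t) * Real.log x ≤ (s - t) * -(κ * n) :=
    mul_le_mul_of_nonneg_left (by linarith) (by linarith)
  nlinarith

/-- Members of the same stage that share a point are equal; this includes the root stage. -/
lemma eq_of_mem_of_mem_stage {X : Type*} {A : ℕ → Set (Set X)} (hroot : ∃! a, a ∈ A 0)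
    (hdisj : ∀ n, 1 ≤ n → ∀ a ∈ A n, ∀ b ∈ A n, a = b ∨ a ∩ b = ∅)
    {n : ℕ} {a b : Set X} (ha : a ∈ A n) (hb : b ∈ A n) {x : X} (hxa : x ∈ a) (hxb : x ∈ b) :
    a = b := by
  rcases Nat.eq_zero_or_pos n with rfl | hn
  · exact hroot.unique ha hb
  · exact (hdisj n hn a ha b hb).resolve_right (nonempty_iff_ne_empty.1 ⟨x, hxa, hxb⟩)

section Tree

variable {X : Type*} [MetricSpace X] {A : ℕ → Set (Set X)}

/-- Distinct members of a finite family of pairwise disjoint compact sets are separated, so a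
given power of the diameter of any bounded set is at most a large multiple of a power of their
distance. -/
lemma eventually_le_mul_dist_rpow {F G : Set (Set X)} (hF : F.Finite) (hG : G.Finite)
    (hcpt : ∀ a ∈ G, IsCompact a)
    (hdisj : ∀ a ∈ G, ∀ b ∈ G, a = b ∨ a ∩ b = ∅) (s : ℝ) {t : ℝ} (ht : 0 < t) :
    ∀ᶠ C : ℝ in atTop, ∀ a ∈ F, ∀ Y ∈ G, ∀ Z ∈ G, Y ≠ Z → ∀ y ∈ Y, ∀ z ∈ Z,
      diam a ^ s ≤ C * dist y z ^ t := by
  refine (eventually_all_finite hF).2 fun a _ => (eventually_all_finite hG).2 fun Y hY =>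
    (eventually_all_finite hG).2 fun Z hZ => ?_
  by_cases hYZ : Y = Z
  · exact Eventually.of_forall fun C h => absurd hYZ h
  obtain ⟨r, hr, h⟩ := exists_pos_forall_lt_edist (hcpt Y hY) (hcpt Z hZ).isClosed
    (disjoint_iff_inter_eq_empty.2 ((hdisj Y hY Z hZ).resolve_left hYZ))
  have hr' : (0 : ℝ) < (r : ℝ) ^ t := Real.rpow_pos_of_pos (by exact_mod_cast hr) t
  filter_upwards [eventually_ge_atTop (diam a ^ s / (r : ℝ) ^ t), eventually_ge_atTop 0]
    with C hC hC0 _ y hy z hz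
  rw [div_le_iff₀ hr'] at hC
  have hd : (r : ℝ) ≤ dist y z := by
    have := (h y hy z hz).le
    rw [edist_nndist, ENNReal.coe_le_coe] at this
    exact_mod_cast this
  exact hC.trans (by gcongr)

/-- Every bounded set is covered, inside the limit set, by a single member of the family whose
`s`-th diameter power is controlled by the `t`-th diameter power of the given set. -/
lemma exists_mem_stage_inter_subset (hfin : ∀ n, (A n).Finite) (hroot : ∃! a, a ∈ A 0)
    (hdisj : ∀ n, 1 ≤ n → ∀ a ∈ A n, ∀ b ∈ A n, a = b ∨ a ∩ b = ∅)
    (hnest : ∀ n, ∀ b ∈ A (n + 1), ∃ a ∈ A n, b ⊆ a)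
    (hsur : ∀ n, ∀ a ∈ A n, ∃ b ∈ A (n + 1), b ⊆ a)
    (hdiam0 : Tendsto (fun n => sSup (diam '' A n)) atTop (nhds 0))
    {s t C : ℝ} (hs : 0 < s) (ht : 0 ≤ t) (hC0 : 0 ≤ C)
    (hC : ∀ n, ∀ a ∈ A n, ∀ Y ∈ A (n + 1), Y ⊆ a → ∀ Z ∈ A (n + 1), Z ⊆ a → Y ≠ Z →
      ∀ y ∈ Y, ∀ z ∈ Z, diam a ^ s ≤ C * dist y z ^ t)
    {U : Set X} (hU : Bornology.IsBounded U) {η : ℝ} (hη : 0 < η) :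
    ∃ n, ∃ a ∈ A n, U ∩ (⋂ n, ⋃₀ A n) ⊆ a ∧ diam a ^ s ≤ C * diam U ^ t + η := by
  classical
  by_cases h : ∀ n, ∃ a ∈ A n, U ∩ (⋂ n, ⋃₀ A n) ⊆ a
  · have hlim : Tendsto (fun n => sSup (diam '' A n) ^ s) atTop (nhds 0) := by
      simpa [Real.zero_rpow hs.ne'] using hdiam0.rpow_const (Or.inr hs.le)
    obtain ⟨n, hn⟩ := (hlim.eventually_lt_const hη).exists
    obtain ⟨a, ha, hUa⟩ := h n
    refine ⟨n, a, ha, hUa, ?_⟩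
    have h1 : diam a ≤ sSup (diam '' A n) :=
      le_csSup ((hfin n).image _).bddAbove (mem_image_of_mem _ ha)
    have h2 : diam a ^ s ≤ sSup (diam '' A n) ^ s := Real.rpow_le_rpow diam_nonneg h1 hs.le
    have h3 : 0 ≤ C * diam U ^ t := mul_nonneg hC0 (Real.rpow_nonneg diam_nonneg _)
    linarith
  · push Not at h
    have hmin := fun {m : ℕ} => Nat.find_min h (m := m)
    have hspec := Nat.find_spec h
    rcases hk : Nat.find h with _ | m
    · rw [hk] at hspec
      obtain ⟨a, ha, hau⟩ := hroot
      refine absurd (fun x hx => ?_) (hspec a ha)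
      obtain ⟨b, hb, hxb⟩ := mem_iInter.1 hx.2 0
      exact hau b hb ▸ hxb
    rw [hk] at hspec
    have hm := hmin (m := m) (by omega)
    push Not at hm
    obtain ⟨a, ha, hUa⟩ := hm
    refine ⟨m, a, ha, hUa, ?_⟩
    obtain ⟨b, hb, -⟩ := hsur m a ha
    obtain ⟨x, hx, -⟩ := not_subset.1 (hspec b hb)
    obtain ⟨Y, hY, hxY⟩ := mem_iInter.1 hx.2 (m + 1)
    obtain ⟨z, hz, hzY⟩ := not_subset.1 (hspec Y hY)
    obtain ⟨Z, hZ, hzZ⟩ := mem_iInter.1 hz.2 (m + 1)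
    have hsub : ∀ {W : Set X} {w : X}, W ∈ A (m + 1) → w ∈ W → w ∈ a → W ⊆ a := by
      intro W w hW hwW hwa
      obtain ⟨a', ha', hWa'⟩ := hnest m W hW
      rwa [eq_of_mem_of_mem_stage hroot hdisj ha ha' hwa (hWa' hwW)]
    have h1 := hC m a ha Y hY (hsub hY hxY (hUa hx)) Z hZ (hsub hZ hzZ (hUa hz))
      (fun e => hzY (e ▸ hzZ)) x hxY z hzZ
    have h2 : C * dist x z ^ t ≤ C * diam U ^ t := by
      gcongr
      exact dist_le_diam_of_mem hU hx.1 hz.1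
    linarith

/-- Every member of a stage is relatively open in the limit set. -/
lemma exists_isOpen_inter_subset (hfin : ∀ n, (A n).Finite) (hroot : ∃! a, a ∈ A 0)
    (hcpt : ∀ n, ∀ a ∈ A n, IsCompact a)
    (hdisj : ∀ n, 1 ≤ n → ∀ a ∈ A n, ∀ b ∈ A n, a = b ∨ a ∩ b = ∅)
    {n : ℕ} {a : Set X} (ha : a ∈ A n) :
    ∃ V, IsOpen V ∧ a ⊆ V ∧ V ∩ (⋂ n, ⋃₀ A n) ⊆ a := by
  refine ⟨(⋃₀ (A n \ {a}))ᶜ, ?_, ?_, ?_⟩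
  · exact (((hfin n).subset sdiff_subset).isCompact_sUnion
      fun b hb => hcpt n b hb.1).isClosed.isOpen_compl
  · rintro x hxa ⟨b, ⟨hb, hba⟩, hxb⟩
    exact hba (eq_of_mem_of_mem_stage hroot hdisj hb ha hxb hxa)
  · rintro x ⟨hx, hxL⟩
    obtain ⟨b, hb, hxb⟩ := mem_iInter.1 hxL n
    by_cases hba : b = a
    · exact hba ▸ hxb
    · exact absurd ⟨b, ⟨hb, hba⟩, hxb⟩ hx

lemma isCompact_limitSet (hfin : ∀ n, (A n).Finite)
    (hcpt : ∀ n, ∀ a ∈ A n, IsCompact a) : IsCompact (⋂ n, ⋃₀ A n) :=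
  have h : ∀ n, IsCompact (⋃₀ A n) := fun n => (hfin n).isCompact_sUnion (hcpt n)
  (h 0).of_isClosed_subset (isClosed_iInter fun n => (h n).isClosed) (iInter_subset _ 0)

end Tree

/-- A null set for the `t`-dimensional Hausdorff measure has countable covers by bounded sets with
arbitrarily small sums of `t`-th powers of diameters. -/
lemma exists_cover_sum_diam_rpow_le {X : Type*} [MetricSpace X] [MeasurableSpace X] [BorelSpace X]
    {t : ℝ} (ht : 0 < t) {L : Set X} (hL : μH[t] L = 0) {ε : ℝ} (hε : 0 < ε) :
    ∃ U : ℕ → Set X, L ⊆ ⋃ n, U n ∧ (∀ n, Bornology.IsBounded (U n)) ∧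
      ∀ F : Finset ℕ, ∑ i ∈ F, diam (U i) ^ t ≤ ε := by
  rw [Measure.hausdorffMeasure_apply, ← bot_eq_zero, iSup₂_eq_bot] at hL
  have h1 := (hL 1 one_pos).trans_lt (bot_lt_iff_ne_bot.2 (ENNReal.ofReal_pos.2 hε).ne')
  simp only [iInf_lt_iff] at h1
  obtain ⟨U, hLU, hU1, hsum⟩ := h1
  refine ⟨U, hLU, fun n => isBounded_iff_ediam_ne_top.2
    ((hU1 n).trans_lt ENNReal.one_lt_top).ne, fun F => ?_⟩
  rw [← ENNReal.ofReal_le_ofReal_iff hε.le,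
    ENNReal.ofReal_sum_of_nonneg fun i _ => Real.rpow_nonneg diam_nonneg _]
  refine (Finset.sum_le_sum fun i _ => ?_).trans ((ENNReal.sum_le_tsum F).trans hsum.le)
  rcases (U i).eq_empty_or_nonempty with h | h
  · simp [h, Real.zero_rpow ht.ne']
  · rw [iSup_pos h, ← ENNReal.ofReal_rpow_of_nonneg diam_nonneg ht.le, diam,
      ENNReal.ofReal_toReal ((hU1 i).trans_lt ENNReal.one_lt_top).ne]

/-- **First Generalized Jarník Lemma.** For a diametrically strongly tree-like family
`A = ⋃ n, A n` of compact sets in a complete metric space, with exponential decay of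
the stage diameters, a separation condition on descendants governed by a sequence
`(B n)`, and the covering sum condition for the exponent `s`, the limit set
`⋂ n, ⋃₀ A n` has Hausdorff dimension at least `s`. -/
theorem first_generalized_jarnik_lemma {X : Type*} [MetricSpace X] [CompleteSpace X]
    [MeasurableSpace X] [BorelSpace X]
    (A : ℕ → Set (Set X))
    (hfin : ∀ n, (A n).Finite)
    (hroot : ∃! a, a ∈ A 0)
    (hcpt : ∀ n, ∀ a ∈ A n, IsCompact a)
    (hpos : ∀ n, ∀ a ∈ A n, 0 < Metric.diam a)
    (hdisj : ∀ n, 1 ≤ n → ∀ a ∈ A n, ∀ b ∈ A n, a = b ∨ a ∩ b = ∅)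
    (hnest : ∀ n, ∀ b ∈ A (n + 1), ∃ a ∈ A n, b ⊆ a)
    (hsur : ∀ n, ∀ a ∈ A n, ∃ b ∈ A (n + 1), b ⊆ a)
    (hdiam0 : Filter.Tendsto (fun n => sSup (Metric.diam '' A n)) Filter.atTop (nhds 0))
    (hgrow : 0 < Filter.liminf
      (fun n : ℕ => ((Real.log (1 / sSup (Metric.diam '' A n)) / n : ℝ) : EReal))
      Filter.atTop)
    (B : ℕ → ℝ)
    (hB : ∀ n, 1 ≤ n → B n ∈ Set.Ioo (0 : ℝ) 1)
    (hBlim : Filter.limsup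
      (fun n : ℕ => ((Real.log (Real.log (1 / B n)) / Real.log n : ℝ) : EReal))
      Filter.atTop < 1)
    (hsep : ∀ n, 1 ≤ n → ∀ a ∈ A n, ∀ Y ∈ A (n + 1), Y ⊆ a → ∀ Z ∈ A (n + 1), Z ⊆ a →
      Y ≠ Z → ∀ y ∈ Y, ∀ z ∈ Z, B n * Metric.diam a ≤ dist y z)
    (s : ℝ) (hs : 0 < s) (c : ℝ) (hc : 0 < c)
    (hcov : ∀ X' : Finset (Set X), (↑X' : Set (Set X)) ⊆ (⋃ n, A n) →
      (⋂ n, ⋃₀ A n) ⊆ ⋃₀ (↑X' : Set (Set X)) →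
      c < ∑ a ∈ X', Metric.diam a ^ s) :
    ENNReal.ofReal s ≤ dimH (⋂ n, ⋃₀ A n) := by
  classical
  by_contra hlt
  obtain ⟨t, hdt, hts⟩ := ENNReal.lt_iff_exists_nnreal_btwn.1 (not_le.1 hlt)
  have ht : (0 : ℝ) < t := by
    exact_mod_cast ENNReal.coe_pos.1 (bot_le.trans_lt hdt)
  have hts : (t : ℝ) < s := by
    rwa [← ENNReal.ofReal_coe_nnreal, ENNReal.ofReal_lt_ofReal_iff hs] at hts
  obtain ⟨N, hN⟩ := eventually_atTop.1
    (eventually_rpow_le_rpow_of_growth hgrow hB hBlim ht hts)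
  have hsmall : ∀ᶠ C : ℝ in atTop, ∀ n ∈ Iio (N + 1), ∀ a ∈ A n, ∀ Y ∈ A (n + 1),
      ∀ Z ∈ A (n + 1), Y ≠ Z → ∀ y ∈ Y, ∀ z ∈ Z, diam a ^ s ≤ C * dist y z ^ (t : ℝ) :=
    (eventually_all_finite (finite_Iio _)).2 fun n _ => eventually_le_mul_dist_rpow (hfin n)
      (hfin (n + 1)) (hcpt (n + 1)) (hdisj (n + 1) (by omega)) s ht
  obtain ⟨C, hC, hC1⟩ := (hsmall.and (eventually_ge_atTop 1)).exists
  have hC0 : 0 < C := one_pos.trans_le hC1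
  have hCall : ∀ n, ∀ a ∈ A n, ∀ Y ∈ A (n + 1), Y ⊆ a → ∀ Z ∈ A (n + 1), Z ⊆ a → Y ≠ Z →
      ∀ y ∈ Y, ∀ z ∈ Z, diam a ^ s ≤ C * dist y z ^ (t : ℝ) := by
    intro n a ha Y hY hYa Z hZ hZa hYZ y hy z hz
    rcases lt_or_ge n (N + 1) with hn | hn
    · exact hC n hn a ha Y hY Z hZ hYZ y hy z hz
    · refine (hN n (by omega) _ _ (hpos n a ha)
        (le_csSup ((hfin n).image _).bddAbove (mem_image_of_mem _ ha))
        (hsep n (by omega) a ha Y hY hYa Z hZ hZa hYZ y hy z hz)).trans ?_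
      exact le_mul_of_one_le_left (Real.rpow_nonneg dist_nonneg _) hC1
  obtain ⟨U, hLU, hUb, hUsum⟩ := exists_cover_sum_diam_rpow_le ht
    (hausdorffMeasure_of_dimH_lt hdt) (ε := c / 2 / C) (by positivity)
  choose n a ha hUa hdiam using fun i : ℕ =>
    exists_mem_stage_inter_subset hfin hroot hdisj hnest hsur hdiam0 hs ht.le hC0.le hCall (hUb i)
      (η := c / 2 / 2 / 2 ^ i) (by positivity)
  choose V hVo haV hVa using fun i => exists_isOpen_inter_subset hfin hroot hcpt hdisj (ha i)
  obtain ⟨F, hF⟩ := (isCompact_limitSet hfin hcpt).elim_finite_subcover V hVo fun x hx => by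
    obtain ⟨i, hi⟩ := mem_iUnion.1 (hLU hx)
    exact mem_iUnion.2 ⟨i, haV i (hUa i ⟨hi, hx⟩)⟩
  have hlow := hcov (F.image a)
    (by
      intro b hb
      obtain ⟨i, -, rfl⟩ := Finset.mem_image.1 (Finset.mem_coe.1 hb)
      exact mem_iUnion.2 ⟨n i, ha i⟩)
    (by
      intro x hx
      obtain ⟨i, hi, hxi⟩ := mem_iUnion₂.1 (hF hx)
      exact ⟨a i, Finset.mem_coe.2 (Finset.mem_image_of_mem a hi), hVa i ⟨hxi, hx⟩⟩)
  have himage : ∑ b ∈ F.image a, diam b ^ s ≤ ∑ i ∈ F, diam (a i) ^ s :=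
    Finset.sum_image_le_of_nonneg fun b _ => Real.rpow_nonneg diam_nonneg _
  have hgeom : ∑ i ∈ F, c / 2 / 2 / 2 ^ i ≤ c / 2 :=
    sum_le_hasSum F (fun i _ => by positivity) (hasSum_geometric_two' (c / 2))
  have hup : ∑ i ∈ F, diam (a i) ^ s ≤
      C * ∑ i ∈ F, diam (U i) ^ (t : ℝ) + ∑ i ∈ F, c / 2 / 2 / 2 ^ i := by
    rw [Finset.mul_sum, ← Finset.sum_add_distrib]
    exact Finset.sum_le_sum fun i _ => hdiam i
  have hbound : C * ∑ i ∈ F, diam (U i) ^ (t : ℝ) ≤ c / 2 := by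
    calc C * ∑ i ∈ F, diam (U i) ^ (t : ℝ) ≤ C * (c / 2 / C) := by gcongr; exact hUsum F
      _ = c / 2 := by field_simp
  linarith
end

section
/- Let A = ⋃_{n≥0} A_n be a diametrically strongly tree-like family of compact subsets of a complete metric space with limit set A_∞ and root A_0 (the unique element of A_0). Let s > 0 and suppose that for every n ≥ 0 and every A ∈ A_n one has Σ_{B ∈ D(A)} diam(B)^s ≥ diam(A)^s. Then there exists c > 0 (for instance any c < diam(A_0)^s) such that every finite subfamily X' ⊆ A with A_∞ ⊆ ⋃_{A ∈ X'} A satisfies Σ_{A ∈ X'} diam(A)^s > c. -/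
open Filter Metric Set

/-- Every member of a nested family is contained in a member of each earlier level. -/
theorem exists_superset_of_le {X : Type*} {A : ℕ → Set (Set X)}
    (hnest : ∀ n, ∀ b ∈ A (n + 1), ∃ a ∈ A n, b ⊆ a) {n m : ℕ} (h : n ≤ m) {b : Set X}
    (hb : b ∈ A m) : ∃ a ∈ A n, b ⊆ a := by
  induction m, h using Nat.le_induction generalizing b with
  | base => exact ⟨b, hb, Subset.rfl⟩
  | succ m _ ih =>
    obtain ⟨a, ha, hba⟩ := hnest m b hb
    obtain ⟨a', ha', haa'⟩ := ih ha
    exact ⟨a', ha', hba.trans haa'⟩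

/-- In a nested family with pairwise disjoint levels, a member that meets a member of an
earlier level is contained in it. -/
theorem subset_of_inter_nonempty_of_le {X : Type*} {A : ℕ → Set (Set X)}
    (hdisj : ∀ n, ∀ a ∈ A n, ∀ b ∈ A n, a = b ∨ a ∩ b = ∅)
    (hnest : ∀ n, ∀ b ∈ A (n + 1), ∃ a ∈ A n, b ⊆ a) {n m : ℕ} (h : n ≤ m) {a b : Set X}
    (ha : a ∈ A n) (hb : b ∈ A m) (hab : (a ∩ b).Nonempty) : b ⊆ a := by
  obtain ⟨a', ha', hba'⟩ := exists_superset_of_le hnest h hb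
  rcases hdisj n a ha a' ha' with rfl | he
  · exact hba'
  · exact absurd he (hab.mono (inter_subset_inter_right a hba')).ne_empty

/-- Every member of a strongly tree-like family of nonempty compact sets meets the limit set. -/
theorem inter_iInter_sUnion_nonempty {X : Type*} [TopologicalSpace X] [T2Space X]
    {A : ℕ → Set (Set X)} (hcpt : ∀ n, ∀ a ∈ A n, IsCompact a)
    (hne : ∀ n, ∀ a ∈ A n, a.Nonempty)
    (hnest : ∀ n, ∀ b ∈ A (n + 1), ∃ a ∈ A n, b ⊆ a)
    (hsur : ∀ n, ∀ a ∈ A n, ∃ b ∈ A (n + 1), b ⊆ a) {N : ℕ} {b : Set X} (hb : b ∈ A N) :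
    (b ∩ ⋂ n, ⋃₀ A n).Nonempty := by
  choose! f hfA hfsub using hsur
  let u : ℕ → Set X := fun k => Nat.rec b (fun k c => f (N + k) c) k
  have hu : ∀ k, u k ∈ A (N + k) := by
    intro k
    induction k with
    | zero => exact hb
    | succ k ih => exact hfA (N + k) (u k) ih
  obtain ⟨p, hp⟩ := IsCompact.nonempty_iInter_of_sequence_nonempty_isCompact_isClosed u
    (fun k => hfsub (N + k) (u k) (hu k)) (fun k => hne _ _ (hu k)) (hcpt _ _ (hu 0))
    (fun k => (hcpt _ _ (hu k)).isClosed)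
  rw [mem_iInter] at hp
  refine ⟨p, hp 0, mem_iInter.2 fun n => ?_⟩
  obtain ⟨a, ha, hsub⟩ := exists_superset_of_le hnest (Nat.le_add_left n N) (hu n)
  exact ⟨a, ha, hsub (hp n)⟩

open Classical in
/-- If a weight on a tree-like family is subadditive along descendants, and every member of
level `N` lies in a member of the finite subfamily `S`, then the weight of a member of level
at most `N` that is not strictly contained in a member of `S` is at most the total weight of the
members of `S` inside it. -/
theorem weight_le_sum_of_forall_subset {X : Type*} {A : ℕ → Set (Set X)} {w : Set X → ℝ}
    (hw : ∀ a, 0 ≤ w a) (hfin : ∀ n, (A n).Finite)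
    (hne : ∀ n, ∀ a ∈ A n, a.Nonempty)
    (hdisj : ∀ n, ∀ a ∈ A n, ∀ b ∈ A n, a = b ∨ a ∩ b = ∅)
    (hnest : ∀ n, ∀ b ∈ A (n + 1), ∃ a ∈ A n, b ⊆ a)
    (hsum : ∀ n, ∀ a ∈ A n, w a ≤ ∑ b ∈ (hfin (n + 1)).toFinset with b ⊆ a, w b)
    {S : Finset (Set X)} (hS : ∀ x ∈ S, ∃ m, x ∈ A m) {N : ℕ}
    (hN : ∀ b ∈ A N, ∃ x ∈ S, b ⊆ x) {n : ℕ} (hn : n ≤ N) {a : Set X} (ha : a ∈ A n)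
    (haS : ∀ x ∈ S, ¬ a ⊂ x) : w a ≤ ∑ x ∈ S with x ⊆ a, w x := by
  have of_mem : ∀ a ∈ S, w a ≤ ∑ x ∈ S with x ⊆ a, w x := fun a ha =>
    Finset.single_le_sum (f := w) (fun x _ => hw x) (Finset.mem_filter.2 ⟨ha, Subset.rfl⟩)
  induction hn using Nat.decreasingInduction generalizing a with
  | self =>
    obtain ⟨x, hx, hax⟩ := hN a ha
    obtain rfl | hss := hax.eq_or_ssubset
    · exact of_mem a hx
    · exact absurd hss (haS x hx)
  | of_succ n _ ih =>
    by_cases haS' : a ∈ S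
    · exact of_mem a haS'
    set D := {b ∈ (hfin (n + 1)).toFinset | b ⊆ a} with hD
    have mem_D : ∀ b ∈ D, b ∈ A (n + 1) ∧ b ⊆ a := fun b hb => by simpa [hD] using hb
    have child_le : ∀ b ∈ D, w b ≤ ∑ x ∈ S with x ⊆ b, w x := by
      intro b hb
      obtain ⟨hbA, hba⟩ := mem_D b hb
      refine ih hbA fun x hx hbx => ?_
      obtain ⟨m, hm⟩ := hS x hx
      obtain ⟨p, hp⟩ := hne _ b hbA
      rcases Nat.lt_or_ge n m with h | h
      · exact hbx.2 (subset_of_inter_nonempty_of_le hdisj hnest h hbA hm ⟨p, hp, hbx.1 hp⟩)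
      · have hax := subset_of_inter_nonempty_of_le hdisj hnest h hm ha ⟨p, hbx.1 hp, hba hp⟩
        obtain rfl | hss := hax.eq_or_ssubset
        · exact haS' hx
        · exact haS x hx hss
    have hpd : (D : Set (Set X)).PairwiseDisjoint fun b => {x ∈ S | x ⊆ b} := by
      intro b hb b' hb' hbb'
      refine Finset.disjoint_left.2 fun x hx hx' => ?_
      rw [Finset.mem_filter] at hx hx'
      obtain ⟨m, hm⟩ := hS x hx.1
      obtain ⟨p, hp⟩ := hne m x hm
      rcases hdisj _ b (mem_D b hb).1 b' (mem_D b' hb').1 with h | h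
      · exact hbb' h
      · exact (h ▸ ⟨hx.2 hp, hx'.2 hp⟩ : p ∈ (∅ : Set X))
    calc w a ≤ ∑ b ∈ D, w b := hsum n a ha
      _ ≤ ∑ b ∈ D, ∑ x ∈ S with x ⊆ b, w x := Finset.sum_le_sum child_le
      _ = ∑ x ∈ D.biUnion fun b => {x ∈ S | x ⊆ b}, w x := (Finset.sum_biUnion hpd).symm
      _ ≤ ∑ x ∈ S with x ⊆ a, w x := by
        refine Finset.sum_le_sum_of_subset_of_nonneg (fun x hx => ?_) fun x _ _ => hw x
        obtain ⟨b, hb, hxb⟩ := Finset.mem_biUnion.1 hx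
        rw [Finset.mem_filter] at hxb ⊢
        exact ⟨hxb.1, hxb.2.trans (mem_D b hb).2⟩

/-- For a diametrically strongly tree-like family with root `A₀` satisfying the
descendant sum condition `Σ_{B ∈ D(A)} diam(B)^s ≥ diam(A)^s`, every finite subfamily
covering the limit set has `s`-dimensional length sum exceeding any `c < diam(A₀)^s`
(in particular such a `c > 0` exists, since `diam A₀ > 0`). -/
theorem jarnik_covering_sum_lower_bound {X : Type*} [MetricSpace X] [CompleteSpace X]
    (A : ℕ → Set (Set X)) (A₀ : Set X)
    (hfin : ∀ n, (A n).Finite)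
    (hroot : A 0 = {A₀})
    (hcpt : ∀ n, ∀ a ∈ A n, IsCompact a)
    (hpos : ∀ n, ∀ a ∈ A n, 0 < Metric.diam a)
    (hdisj : ∀ n, 1 ≤ n → ∀ a ∈ A n, ∀ b ∈ A n, a = b ∨ a ∩ b = ∅)
    (hnest : ∀ n, ∀ b ∈ A (n + 1), ∃ a ∈ A n, b ⊆ a)
    (hsur : ∀ n, ∀ a ∈ A n, ∃ b ∈ A (n + 1), b ⊆ a)
    (hdiam0 : Filter.Tendsto (fun n => sSup (Metric.diam '' A n)) Filter.atTop (nhds 0))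
    (s : ℝ) (hs : 0 < s)
    (hsum : ∀ n, ∀ a ∈ A n,
      ENNReal.ofReal (Metric.diam a ^ s) ≤
        ∑' b : {b : Set X // b ∈ A (n + 1) ∧ b ⊆ a},
          ENNReal.ofReal (Metric.diam (b : Set X) ^ s)) :
    ∀ c : ℝ, c < Metric.diam A₀ ^ s →
      ∀ X' : Finset (Set X), (↑X' : Set (Set X)) ⊆ (⋃ n, A n) →
        (⋂ n, ⋃₀ A n) ⊆ ⋃₀ (↑X' : Set (Set X)) →
        c < ∑ a ∈ X', Metric.diam a ^ s := by
  classical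
  intro c hc S hSA hcover
  have hw : ∀ a : Set X, 0 ≤ Metric.diam a ^ s := fun a => Real.rpow_nonneg Metric.diam_nonneg s
  have hne : ∀ n, ∀ a ∈ A n, a.Nonempty := by
    intro n a ha
    rw [nonempty_iff_ne_empty]
    rintro rfl
    simpa using hpos n ∅ ha
  have hdisj' : ∀ n, ∀ a ∈ A n, ∀ b ∈ A n, a = b ∨ a ∩ b = ∅ := by
    intro n a ha b hb
    rcases Nat.eq_zero_or_pos n with rfl | hn
    · rw [hroot] at ha hb
      exact Or.inl (ha.trans hb.symm)
    · exact hdisj n hn a ha b hb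
  have hsum' : ∀ n, ∀ a ∈ A n, Metric.diam a ^ s ≤
      ∑ b ∈ (hfin (n + 1)).toFinset with b ⊆ a, Metric.diam b ^ s := by
    intro n a ha
    have hcoe : {b : Set X | b ∈ A (n + 1) ∧ b ⊆ a} =
        ({b ∈ (hfin (n + 1)).toFinset | b ⊆ a} : Finset (Set X)) := by
      ext b
      simp
    have h := hsum n a ha
    change _ ≤ ∑' b : {b : Set X | b ∈ A (n + 1) ∧ b ⊆ a},
      ENNReal.ofReal (Metric.diam (b : Set X) ^ s) at h
    rw [hcoe, Finset.tsum_subtype' _ fun b => ENNReal.ofReal (Metric.diam b ^ s),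
      ← ENNReal.ofReal_sum_of_nonneg fun b _ => hw b] at h
    exact (ENNReal.ofReal_le_ofReal_iff (Finset.sum_nonneg fun b _ => hw b)).1 h
  have hS : ∀ x ∈ S, ∃ m, x ∈ A m := fun x hx => mem_iUnion.1 (hSA hx)
  choose! lev hlev using hS
  have hN : ∀ b ∈ A (S.sup lev), ∃ x ∈ S, b ⊆ x := by
    intro b hb
    obtain ⟨p, hpb, hp⟩ := inter_iInter_sUnion_nonempty hcpt hne hnest hsur hb
    obtain ⟨x, hx, hpx⟩ := hcover hp
    exact ⟨x, hx, subset_of_inter_nonempty_of_le hdisj' hnest (Finset.le_sup hx)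
      (hlev x hx) hb ⟨p, hpx, hpb⟩⟩
  have hA₀ : A₀ ∈ A 0 := hroot ▸ mem_singleton A₀
  have hmax : ∀ x ∈ S, ¬ A₀ ⊂ x := by
    intro x hx hss
    obtain ⟨a, ha, hxa⟩ := exists_superset_of_le hnest (Nat.zero_le _) (hlev x hx)
    rw [hroot, mem_singleton_iff] at ha
    exact hss.2 (ha ▸ hxa)
  calc c < Metric.diam A₀ ^ s := hc
    _ ≤ ∑ x ∈ S with x ⊆ A₀, Metric.diam x ^ s :=
      weight_le_sum_of_forall_subset hw hfin hne hdisj' hnest hsum'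
        (fun x hx => ⟨lev x, hlev x hx⟩) hN (Nat.zero_le _) hA₀ hmax
    _ ≤ ∑ x ∈ S, Metric.diam x ^ s :=
      Finset.sum_le_sum_of_subset_of_nonneg (Finset.filter_subset _ S) fun x _ _ => hw x
end
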